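/- For every x in the interval [φ, 1/2], it holds that P(pile(x)) + x·ξ(x) ≥ R. -/

import Mathlib

open Real

noncomputable def R : ℝ := 1 / (1 + Real.log 2)

noncomputable def f (x : ℝ) : ℝ :=
  if x ≤ R then 1/2 else (2 * Real.exp 1) ^ (x - 1)

noncomputable def F (x : ℝ) : ℝ :=
  if x ≤ R then x/2 else R * (2 * Real.exp 1) ^ (x - 1)

noncomputable def P (c : ℝ) : ℝ := ∫ y in (0:ℝ)..1, min (f y) c

noncomputable def Q (c : ℝ) : ℝ := ∫ y in (0:ℝ)..1, max (c - f y) 0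

noncomputable def xic : ℝ := (1 + (2/3) * Real.log (4/3)) * R - 2/3

noncomputable def phi : ℝ := (2/3) * xic / (2/3 - R + xic)

noncomputable def xi (x : ℝ) : ℝ :=
  if x ≤ 1/3 then xic / x else 9 * xic * (1 - 2 * x)

noncomputable def T (a b : ℝ) : ℝ := (a + b - 1/2) * (xi b - xi a)

noncomputable def pile (x : ℝ) : ℝ := max (2/3) (2 * x)

theorem one_add_log_two_pos : 0 < 1 + Real.log 2 := by
  have := Real.log_pos (one_lt_two)
  linarith

theorem R_pos : 0 < R := one_div_pos.2 one_add_log_two_pos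

theorem R_mul_one_add_log_two : R * (1 + Real.log 2) = 1 :=
  one_div_mul_cancel one_add_log_two_pos.ne'

theorem log_two_eq : Real.log 2 = R⁻¹ - 1 := by
  simp [R]

theorem R_lt_two_thirds : R < 2 / 3 := by
  have h := Real.log_two_gt_d9
  have h1 := R_mul_one_add_log_two
  have h2 := R_pos
  nlinarith

theorem two_mul_exp_one_rpow (x : ℝ) :
    (2 * Real.exp 1) ^ (x - 1) = Real.exp ((x - 1) / R) := by
  rw [Real.rpow_def_of_pos (by positivity), Real.log_mul (by norm_num) (Real.exp_pos 1).ne',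
    Real.log_exp, log_two_eq]
  congr 1
  ring

theorem exp_R_sub_one_div_R : Real.exp ((R - 1) / R) = 1 / 2 := by
  have h : (R - 1) / R = -Real.log 2 := by
    rw [log_two_eq]
    field_simp [R_pos.ne']
    ring
  rw [h, Real.exp_neg, Real.exp_log two_pos, one_div]

theorem f_eq_max (x : ℝ) : f x = max (1 / 2) (Real.exp ((x - 1) / R)) := by
  have hR := R_pos
  unfold f
  split_ifs with h
  · rw [max_eq_left]
    rw [← exp_R_sub_one_div_R]
    gcongr
  · rw [two_mul_exp_one_rpow, max_eq_right]
    rw [← exp_R_sub_one_div_R]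
    push Not at h
    gcongr

theorem continuous_f : Continuous f := by
  rw [funext f_eq_max]
  fun_prop

theorem integral_exp_sub_one_div_R (a b : ℝ) :
    ∫ y in a..b, Real.exp ((y - 1) / R) =
      R * Real.exp ((b - 1) / R) - R * Real.exp ((a - 1) / R) := by
  have hR := R_pos.ne'
  refine intervalIntegral.integral_eq_sub_of_hasDerivAt
    (f := fun y => R * Real.exp ((y - 1) / R)) (fun x _ => ?_)
    (Continuous.intervalIntegrable (by fun_prop) _ _)
  have h := ((((hasDerivAt_id x).sub_const 1).div_const R).exp).const_mul R
  exact h.congr_deriv (by simp only [id]; field_simp)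

theorem P_eq {c : ℝ} (hc : 1 / 2 ≤ c) (hc1 : c ≤ 1) : P c = R * (c + Real.negMulLog c) := by
  have hR := R_pos
  have hc0 : 0 < c := by linarith
  have hlog : Real.log c ≤ 0 := Real.log_nonpos hc0.le hc1
  have hlog2 : -Real.log 2 ≤ Real.log c := by
    rw [← Real.log_inv]
    exact Real.log_le_log (by norm_num) (by linarith)
  have hm := R_mul_one_add_log_two
  set z := 1 + R * Real.log c with hz
  have hRz : R ≤ z := by nlinarith
  have hz1 : z ≤ 1 := by nlinarith
  have hexpz : Real.exp ((z - 1) / R) = c := by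
    rw [hz, add_sub_cancel_left, mul_div_cancel_left₀ _ hR.ne', Real.exp_log hc0]
  have hint (a b : ℝ) : IntervalIntegrable (fun y => min (f y) c) MeasureTheory.volume a b :=
    (continuous_f.min continuous_const).intervalIntegrable a b
  have h₁ : ∫ y in (0 : ℝ)..R, min (f y) c = R / 2 := by
    have : ∫ y in (0 : ℝ)..R, min (f y) c = ∫ _ in (0 : ℝ)..R, (1 / 2 : ℝ) := by
      refine intervalIntegral.integral_congr fun y hy => ?_
      rw [Set.uIcc_of_le hR.le] at hy
      simp only [f, if_pos hy.2]
      exact min_eq_left hc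
    rw [this, intervalIntegral.integral_const, smul_eq_mul]
    ring
  have h₂ : ∫ y in R..z, min (f y) c = R * c - R * (1 / 2) := by
    have : ∫ y in R..z, min (f y) c = ∫ y in R..z, Real.exp ((y - 1) / R) := by
      refine intervalIntegral.integral_congr fun y hy => ?_
      rw [Set.uIcc_of_le hRz] at hy
      have hl : 1 / 2 ≤ Real.exp ((y - 1) / R) := by
        rw [← exp_R_sub_one_div_R]
        gcongr
        exact hy.1
      have hu : Real.exp ((y - 1) / R) ≤ c := by
        rw [← hexpz]
        gcongr
        exact hy.2
      simp only [f_eq_max]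
      rw [max_eq_right hl, min_eq_left hu]
    rw [this, integral_exp_sub_one_div_R, hexpz, exp_R_sub_one_div_R]
  have h₃ : ∫ y in z..1, min (f y) c = (1 - z) * c := by
    have : ∫ y in z..1, min (f y) c = ∫ _ in z..1, c := by
      refine intervalIntegral.integral_congr fun y hy => ?_
      rw [Set.uIcc_of_le hz1] at hy
      have hl : c ≤ Real.exp ((y - 1) / R) := by
        rw [← hexpz]
        gcongr
        exact hy.1
      simp only [f_eq_max]
      exact min_eq_right (hl.trans (le_max_right _ _))
    rw [this, intervalIntegral.integral_const, smul_eq_mul]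
  rw [P, ← intervalIntegral.integral_add_adjacent_intervals (hint 0 z) (hint z 1),
    ← intervalIntegral.integral_add_adjacent_intervals (hint 0 R) (hint R z), h₁, h₂, h₃, hz,
    Real.negMulLog]
  ring

theorem log_four_thirds : Real.log (4 / 3) = Real.log (2 / 3) + Real.log 2 := by
  rw [← Real.log_mul (by norm_num) (by norm_num)]
  norm_num

theorem xic_eq : xic = R * (1 / 3 + 2 / 3 * Real.log (2 / 3)) := by
  rw [xic, log_four_thirds]
  linear_combination (2 / 3) * R_mul_one_add_log_two

theorem xic_pos : 0 < xic := by
  have h : Real.log (3 / 2) < 3 / 2 - 1 :=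
    Real.log_lt_sub_one_of_pos (by norm_num) (by norm_num)
  have h' : Real.log (2 / 3) = -Real.log (3 / 2) := by
    rw [← Real.log_inv]
    norm_num
  rw [xic_eq]
  refine mul_pos R_pos ?_
  linarith

theorem phi_pos : 0 < phi := by
  have h := xic_pos
  have h' := R_lt_two_thirds
  exact div_pos (by positivity) (by linarith)

theorem P_two_thirds_add_xic : P (2 / 3) + xic = R := by
  rw [P_eq (by norm_num) (by norm_num), xic_eq, Real.negMulLog]
  ring

theorem negMulLog_chord_le {c : ℝ} (hc : 2 / 3 ≤ c) (hc1 : c ≤ 1) :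
    3 * (1 - c) * Real.negMulLog (2 / 3) ≤ Real.negMulLog c := by
  have hmem : (2 / 3 : ℝ) ∈ Set.Ici 0 := by norm_num
  have hmem' : (1 : ℝ) ∈ Set.Ici 0 := by norm_num
  have h := Real.concaveOn_negMulLog.2 hmem hmem' (show 0 ≤ 3 * (1 - c) by linarith)
    (show 0 ≤ 3 * c - 2 by linarith) (by ring)
  simp only [smul_eq_mul, Real.negMulLog_one, mul_zero, add_zero] at h
  rwa [show 3 * (1 - c) * (2 / 3) + (3 * c - 2) * 1 = c by ring] at h

theorem stmt_12 : ∀ x ∈ Set.Icc phi (1/2 : ℝ), P (pile x) + x * xi x ≥ R := by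
  rintro x ⟨hx, hx2⟩
  have hx0 : 0 < x := phi_pos.trans_le hx
  have hP := P_two_thirds_add_xic
  by_cases h : x ≤ 1 / 3
  · rw [pile, max_eq_left (by linarith), xi, if_pos h, mul_div_cancel₀ _ hx0.ne']
    exact hP.ge
  · rw [pile, max_eq_right (by linarith), xi, if_neg h, P_eq (by linarith) (by linarith)]
    rw [P_eq (by norm_num) (by norm_num)] at hP
    push Not at h
    have hchord := mul_le_mul_of_nonneg_left
      (negMulLog_chord_le (c := 2 * x) (by linarith) (by linarith)) R_pos.le
    have hquad : 0 ≤ xic * ((x - 1 / 3) * (1 - 2 * x)) :=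
      mul_nonneg xic_pos.le (mul_nonneg (by linarith) (by linarith))
    linear_combination hchord + 9 * hquad - (3 * (1 - 2 * x)) * hP
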